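/- arXiv:1809.05116 — 3 statements merged into one kernel-verified Lean document; each statement's English description precedes it below -/
import Mathlib

section
/- Let (P, ⊕, ·) be a semifield. Then the multiplicative group (P, ·) is torsion-free: for every p ∈ P and every integer n ≥ 1, if p^n = 1 then p = 1. -/
/-- In a semifield `(P, ⊕, ·)` — an abelian multiplicative group `P` endowed with an
auxiliary addition `⊕` that is commutative, associative and distributive over the
multiplication — the multiplicative group is torsion-free: `p ^ n = 1` with `n ≥ 1`
implies `p = 1`. -/
theorem semifield_torsionFree {P : Type*} [CommGroup P]
    (sadd : P → P → P)
    (sadd_comm : ∀ a b : P, sadd a b = sadd b a)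
    (sadd_assoc : ∀ a b c : P, sadd (sadd a b) c = sadd a (sadd b c))
    (sadd_distrib : ∀ a b c : P, sadd a b * c = sadd (a * c) (b * c))
    (p : P) (n : ℕ) (hn : 1 ≤ n) (hpn : p ^ n = 1) : p = 1 := by
  let S : ℕ → P := fun k => Nat.rec 1 (fun k s => sadd s (p ^ (k + 1))) k
  have S0 : S 0 = 1 := rfl
  have S1 : ∀ k, S (k + 1) = sadd (S k) (p ^ (k + 1)) := fun k => rfl
  have key : ∀ k, sadd (S k * p) 1 = S (k + 1) := by
    intro k
    induction k with
    | zero => rw [S1, S0, sadd_comm]; simp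
    | succ k ih =>
      have e : S (k + 1) * p = sadd (S k * p) (p ^ (k + 1 + 1)) := by
        rw [S1 k, sadd_distrib, ← pow_succ]
      rw [S1 (k + 1), e, ← ih, sadd_assoc, sadd_assoc, sadd_comm 1]
  obtain ⟨m, rfl⟩ : ∃ m, n = m + 1 := ⟨n - 1, by omega⟩
  cases m with
  | zero => simpa using hpn
  | succ j =>
    have h : S (j + 1) * p = S (j + 1) := by
      rw [S1 j, sadd_distrib, ← pow_succ, hpn, key j, S1 j]
    exact mul_eq_left.mp h
end

section
/- Let (P, ⊕, ·) be a semifield. Then the integral group ring ℤP of the multiplicative group (P, ·) (the monoid algebra of P over ℤ) is an integral domain. -/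
theorem semifield_aux_torsion {P : Type*} [CommGroup P]
    (sadd : P → P → P)
    (sadd_comm : ∀ a b : P, sadd a b = sadd b a)
    (sadd_assoc : ∀ a b c : P, sadd (sadd a b) c = sadd a (sadd b c))
    (sadd_distrib : ∀ a b c : P, sadd a b * c = sadd (a * c) (b * c))
    (x : P) (n : ℕ) (hn : n ≠ 0) (hx : x ^ n = 1) : x = 1 := by
  let f : ℕ → P := fun k => Nat.rec 1 (fun i s => sadd s (x ^ (i + 1))) k
  have f0 : f 0 = 1 := rfl
  have fs : ∀ k, f (k + 1) = sadd (f k) (x ^ (k + 1)) := fun _ => rfl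
  have key : ∀ k, sadd (f k * x) 1 = f (k + 1) := by
    intro k
    induction k with
    | zero => rw [fs, f0, one_mul, zero_add, pow_one, sadd_comm]
    | succ k ih =>
      have e : f (k + 1) * x = sadd (f k * x) (x ^ (k + 1 + 1)) := by
        rw [fs k, sadd_distrib, ← pow_succ]
      rw [e, fs (k + 1), ← ih, sadd_assoc, sadd_assoc, sadd_comm 1]
  match n, hn, hx with
  | 1, _, hx => simpa using hx
  | k + 2, _, hx =>
    have h : f (k + 1) * x = f (k + 1) := by
      conv_lhs => rw [fs, sadd_distrib, ← pow_succ, hx, key]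
    exact mul_eq_left.mp h

theorem semifield_aux_unique {P : Type*} [CommGroup P] [IsMulTorsionFree P] :
    UniqueProds P := by
  classical
  refine ⟨fun {A B} hA hB => ?_⟩
  let S := Subgroup.closure ((A ∪ B : Finset P) : Set P)
  have hfg : Group.FG S := (Group.fg_iff_subgroup_fg S).2 ⟨A ∪ B, rfl⟩
  have : Monoid.FG S := Group.fg_iff_monoid_fg.1 hfg
  have : IsMulTorsionFree S :=
    Function.Injective.isMulTorsionFree S.subtype S.subtype_injective
  have hAS : ∀ a ∈ A, a ∈ S := fun a ha => Subgroup.subset_closure (by simp [ha])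
  have hBS : ∀ a ∈ B, a ∈ S := fun a ha => Subgroup.subset_closure (by simp [ha])
  obtain ⟨a0, ha0⟩ := hA
  obtain ⟨b0, hb0⟩ := hB
  obtain ⟨a, ha, b, hb, h⟩ := UniqueProds.uniqueMul_of_nonempty
    (A := A.subtype (· ∈ S)) (B := B.subtype (· ∈ S))
    ⟨⟨a0, hAS _ ha0⟩, by simpa using ha0⟩ ⟨⟨b0, hBS _ hb0⟩, by simpa using hb0⟩
  refine ⟨a, by simpa using ha, b, by simpa using hb, ?_⟩
  intro c d hc hd hcd
  have := @h ⟨c, hAS _ hc⟩ ⟨d, hBS _ hd⟩ (by simpa using hc) (by simpa using hd)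
    (Subtype.ext hcd)
  exact ⟨congrArg Subtype.val this.1, congrArg Subtype.val this.2⟩


/-- For a semifield `(P, ⊕, ·)` — an abelian multiplicative group `P` endowed with an
auxiliary addition `⊕` that is commutative, associative and distributive over the
multiplication — the integral group ring `ℤP` (the monoid algebra of `P` over `ℤ`)
is an integral domain. -/
theorem semifield_groupRing_isDomain {P : Type*} [CommGroup P]
    (sadd : P → P → P)
    (sadd_comm : ∀ a b : P, sadd a b = sadd b a)
    (sadd_assoc : ∀ a b c : P, sadd (sadd a b) c = sadd a (sadd b c))
    (sadd_distrib : ∀ a b c : P, sadd a b * c = sadd (a * c) (b * c)) :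
    IsDomain (MonoidAlgebra ℤ P) := by

  have : IsMulTorsionFree P := by
    refine ⟨fun n hn a b hab => ?_⟩
    have h : (a / b) ^ n = 1 := by
      rw [div_pow]
      exact div_eq_one.2 hab
    exact div_eq_one.1
      (semifield_aux_torsion sadd sadd_comm sadd_assoc sadd_distrib _ n hn h)
  have := semifield_aux_unique (P := P)
  infer_instance
end

section
/- Let (P, ⊕, ·) be a semifield, let n ≥ 1, let B = (b_{ij}) be an n×n integer matrix, let y = (y_1,…,y_n) be an n-tuple of elements of P, and let k ∈ {1,…,n}. Define the mutated coefficient tuple y' = (y'_1,…,y'_n) by y'_k = y_k^{−1} and y'_i = y_i · y_k^{max(b_{ki},0)} · (1 ⊕ y_k)^{−b_{ki}} for i ≠ k (where 1 denotes the identity of the group (P,·) and powers are integer powers in the group), and let B' = μ_k(B). Then applying the same mutation rule in direction k to the pair (y', B') recovers y: that is, (y')'_k = y_k and (y')'_i = y'_i · (y'_k)^{max(b'_{ki},0)} · (1 ⊕ y'_k)^{−b'_{ki}} = y_i for every i ≠ k. In other words, coefficient mutation in direction k is an involution. -/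
/-- Matrix mutation in direction `k` of an `n × n` integer matrix `B`. -/
def matrixMutation {n : ℕ} (k : Fin n) (B : Matrix (Fin n) (Fin n) ℤ) :
    Matrix (Fin n) (Fin n) ℤ :=
  fun i j =>
    if i = k ∨ j = k then -B i j
    else B i j + Int.sign (B i k) * max (B i k * B k j) 0

/-- Coefficient mutation in direction `k` is an involution.  Here `(P, ⊕, ·)` is a
semifield (an abelian multiplicative group with a commutative, associative auxiliary
addition `⊕` distributing over `·`); `y'` is the mutation in direction `k` of the
coefficient tuple `y` with respect to the exchange matrix `B`, and `B' = μ_k(B)`.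
Mutating `(y', B')` in direction `k` recovers `y`. -/
theorem coefficientMutation_involutive {P : Type*} [CommGroup P]
    (sadd : P → P → P)
    (sadd_comm : ∀ a b : P, sadd a b = sadd b a)
    (sadd_assoc : ∀ a b c : P, sadd (sadd a b) c = sadd a (sadd b c))
    (sadd_distrib : ∀ a b c : P, sadd a b * c = sadd (a * c) (b * c))
    {n : ℕ} (hn : 1 ≤ n) (B : Matrix (Fin n) (Fin n) ℤ) (k : Fin n)
    (y y' : Fin n → P)
    (hy'k : y' k = (y k)⁻¹)
    (hy' : ∀ i, i ≠ k → y' i = y i * y k ^ max (B k i) 0 * (sadd 1 (y k)) ^ (-(B k i)))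
    (B' : Matrix (Fin n) (Fin n) ℤ) (hB' : B' = matrixMutation k B) :
    (y' k)⁻¹ = y k ∧
      ∀ i, i ≠ k → y' i * y' k ^ max (B' k i) 0 * (sadd 1 (y' k)) ^ (-(B' k i)) = y i := by
  refine ⟨by rw [hy'k, inv_inv], ?_⟩
  intro i hi
  have hs : sadd 1 (y k)⁻¹ = sadd 1 (y k) * (y k)⁻¹ := by
    rw [sadd_distrib, one_mul, mul_inv_cancel, sadd_comm]
  have hb : B' k i = -(B k i) := by
    rw [hB']; simp [matrixMutation]
  rw [hb, hy'k, hs, hy' i hi, neg_neg, mul_zpow, inv_zpow', inv_zpow']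
  generalize sadd 1 (y k) = s
  generalize B k i = b
  have h1 : y k ^ max b 0 * y k ^ (-max (-b) 0) * y k ^ (-b) = 1 := by
    rw [← zpow_add, ← zpow_add]
    have : max b 0 + -max (-b) 0 + -b = 0 := by omega
    rw [this, zpow_zero]
  have h2 : s ^ (-b) * s ^ b = 1 := by
    rw [← zpow_add, neg_add_cancel, zpow_zero]
  calc y i * y k ^ max b 0 * s ^ (-b) * y k ^ (-max (-b) 0) * (s ^ b * y k ^ (-b))
      = y i * (y k ^ max b 0 * y k ^ (-max (-b) 0) * y k ^ (-b)) * (s ^ (-b) * s ^ b) := by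
        ac_rfl
    _ = y i := by rw [h1, h2, mul_one, mul_one]
end
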